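/- Let N ≥ 1 be odd and let λ > 0. Then any N distinct pairs (j₁,l₁),...,(j_N,l_N) with j_k, l_k ∈ {0,...,N-1} give rise to a finite Gabor frame for ℂ^N with window h_N^λ, the periodization h_N^λ[m] = ∑_{j∈ℤ} e^{-πλ(m/N - j)²}: there are A, B > 0 with A‖f‖² ≤ ∑_{k=1}^N |V_{h_N^λ}f[j_k,l_k]|² ≤ B‖f‖² for all f ∈ ℂ^N. Equivalently, the sampled periodized Gaussian is in general linear position when N is odd. -/

import Mathlib

open Complex Finset

/-- The finite (discrete) Gabor transform of `f` with window `g` on `ℤ/Nℤ`. -/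
noncomputable def finiteGabor {N : ℕ} [NeZero N] (g f : ZMod N → ℂ) (k l : ZMod N) : ℂ :=
  ∑ m : ZMod N, f m * (starRingEnd ℂ) (g (m - k)) *
    Complex.exp (-2 * Real.pi * Complex.I * (l.val : ℂ) * (m.val : ℂ) / N)

/-- The periodized and sampled dilated Gaussian window in `ℂ^N`. -/
noncomputable def periodizedGaussian (N : ℕ) [NeZero N] (lam : ℝ) : ZMod N → ℂ :=
  fun m => ((∑' j : ℤ, Real.exp (-Real.pi * lam * ((m.val : ℝ) / N - j) ^ 2) : ℝ) : ℂ)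

/-- If `f` vanishes at every zero of `s`, and all zeros of `s` are simple, then `s` divides `f`
among entire functions. -/
lemma exists_differentiable_eq_mul {s f : ℂ → ℂ} (hs : Differentiable ℂ s)
    (hf : Differentiable ℂ f) (hsimple : ∀ z, s z = 0 → deriv s z ≠ 0)
    (hzero : ∀ z, s z = 0 → f z = 0) :
    ∃ g : ℂ → ℂ, Differentiable ℂ g ∧ ∀ z, f z = s z * g z := by
  classical
  let g : ℂ → ℂ := fun z => if s z = 0 then deriv f z / deriv s z else f z / s z
  refine ⟨g, fun z => ?_, fun z => ?_⟩
  · by_cases hz : s z = 0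
    · have hds : DifferentiableAt ℂ (dslope s z) z :=
        ((Complex.differentiableOn_dslope Filter.univ_mem).2 hs.differentiableOn).differentiableAt
          Filter.univ_mem
      have hdf : DifferentiableAt ℂ (dslope f z) z :=
        ((Complex.differentiableOn_dslope Filter.univ_mem).2 hf.differentiableOn).differentiableAt
          Filter.univ_mem
      have hne : dslope s z z ≠ 0 := by simpa using hsimple z hz
      refine (hdf.div hds hne).congr_of_eventuallyEq ?_
      filter_upwards [hds.continuousAt.eventually_ne hne] with w hw
      by_cases hwz : w = z
      · subst hwz
        simp [g, hz]
      · have h1 : s w = (w - z) * dslope s z w := by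
          have := sub_smul_dslope s z w
          rw [smul_eq_mul, hz, sub_zero] at this
          exact this.symm
        have h2 : f w = (w - z) * dslope f z w := by
          have := sub_smul_dslope f z w
          rw [smul_eq_mul, hzero z hz, sub_zero] at this
          exact this.symm
        have h3 : w - z ≠ 0 := sub_ne_zero.2 hwz
        have h4 : s w ≠ 0 := by rw [h1]; exact mul_ne_zero h3 hw
        simp only [g, if_neg h4, Pi.div_apply]
        rw [h1, h2, mul_div_mul_left _ _ h3]
    · refine ((hf z).div (hs z) hz).congr_of_eventuallyEq ?_
      filter_upwards [(hs z).continuousAt.eventually_ne hz] with w hw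
      simp [g, hw]
  · by_cases hz : s z = 0
    · simp [hz, hzero z hz]
    · simp only [g, if_neg hz]
      field_simp

lemma exists_differentiable_eq_prod_mul {ι : Type*} (t : Finset ι) {s : ι → ℂ → ℂ} {f : ℂ → ℂ}
    (hs : ∀ i, Differentiable ℂ (s i)) (hf : Differentiable ℂ f)
    (hsimple : ∀ i z, s i z = 0 → deriv (s i) z ≠ 0)
    (hdisj : ∀ i j z, s i z = 0 → s j z = 0 → i = j)
    (hzero : ∀ i z, s i z = 0 → f z = 0) :
    ∃ g : ℂ → ℂ, Differentiable ℂ g ∧ ∀ z, f z = (∏ i ∈ t, s i z) * g z := by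
  classical
  induction t using Finset.induction_on with
  | empty => exact ⟨f, hf, by simp⟩
  | insert a t ha ih =>
    obtain ⟨g, hg, hfg⟩ := ih
    obtain ⟨k, hk, hgk⟩ := exists_differentiable_eq_mul (hs a) hg (hsimple a) (fun z hz => by
      have h := hzero a z hz
      rw [hfg, mul_eq_zero] at h
      refine h.resolve_left (Finset.prod_ne_zero_iff.2 fun i hi h0 => ha ?_)
      rwa [hdisj a i z hz h0])
    refine ⟨k, hk, fun z => ?_⟩
    rw [hfg, hgk, Finset.prod_insert ha]
    ring

lemma eq_zero_of_prod_mul_eq_zero {ι : Type*} (t : Finset ι) {s : ι → ℂ → ℂ} {g : ℂ → ℂ}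
    (hs : ∀ i, Differentiable ℂ (s i)) (hne : ∀ i, ∃ z, s i z ≠ 0) (hg : Differentiable ℂ g)
    (h : ∀ z, (∏ i ∈ t, s i z) * g z = 0) (z : ℂ) : g z = 0 := by
  classical
  induction t using Finset.induction_on with
  | empty => simpa using h z
  | insert a t ha ih =>
    refine ih fun w => ?_
    have hprod : Differentiable ℂ fun z => (∏ i ∈ t, s i z) * g z :=
      (Differentiable.fun_finsetProd fun i _ => hs i).mul hg
    have := AnalyticOnNhd.eq_zero_or_eq_zero_of_mul_eq_zero (U := Set.univ)
      ((hs a).differentiableOn.analyticOnNhd isOpen_univ)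
      (hprod.differentiableOn.analyticOnNhd isOpen_univ)
      (fun z _ => by
        have := h z
        rw [Finset.prod_insert ha, mul_assoc] at this
        exact this) isPreconnected_univ
    rcases this with h0 | h0
    · obtain ⟨z, hz⟩ := hne a
      exact absurd (h0 z trivial) hz
    · exact h0 w trivial

/-- An entire function whose norm is periodic in a real and in an imaginary direction is
constant. -/
lemma apply_eq_apply_of_periodic_norm {f : ℂ → ℂ} (hf : Differentiable ℂ f) {a b : ℝ}
    (ha : 0 < a) (hb : 0 < b) (hpa : ∀ z, ‖f (z + a)‖ = ‖f z‖)
    (hpb : ∀ z, ‖f (z + b * I)‖ = ‖f z‖) (z w : ℂ) : f z = f w := by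
  refine hf.apply_eq_apply_of_bounded ?_ z w
  have hK : IsCompact (Set.Icc (0 : ℝ) a ×ℂ Set.Icc (0 : ℝ) b) :=
    isCompact_Icc.reProdIm isCompact_Icc
  obtain ⟨C, hC⟩ := hK.exists_bound_of_continuousOn hf.continuous.continuousOn
  refine isBounded_iff_forall_norm_le.2 ⟨C, ?_⟩
  rintro _ ⟨z, rfl⟩
  have hpa' : Function.Periodic (fun z => ‖f z‖) (a : ℂ) := hpa
  have hpb' : Function.Periodic (fun z => ‖f z‖) (b * I : ℂ) := hpb
  have hm := toIcoMod_mem_Ico ha 0 z.re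
  have hn := toIcoMod_mem_Ico hb 0 z.im
  have h1 := (hpa'.int_mul (-toIcoDiv ha 0 z.re)) (z + ((-toIcoDiv hb 0 z.im : ℤ) : ℂ) * (b * I))
  have h2 := (hpb'.int_mul (-toIcoDiv hb 0 z.im)) z
  rw [← h2, ← h1]
  refine hC _ ?_
  rw [zero_add] at hm hn
  rw [mem_reProdIm]
  constructor
  · have : (z + ((-toIcoDiv hb 0 z.im : ℤ) : ℂ) * (b * I) +
        ((-toIcoDiv ha 0 z.re : ℤ) : ℂ) * a).re = toIcoMod ha 0 z.re := by
      rw [toIcoMod, zsmul_eq_mul]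
      simp [-self_sub_toIcoDiv_zsmul, -self_sub_toIcoDiv_mul]
      ring
    rw [this]
    exact ⟨hm.1, hm.2.le⟩
  · have : (z + ((-toIcoDiv hb 0 z.im : ℤ) : ℂ) * (b * I) +
        ((-toIcoDiv ha 0 z.re : ℤ) : ℂ) * a).im = toIcoMod hb 0 z.im := by
      rw [toIcoMod, zsmul_eq_mul]
      simp [-self_sub_toIcoDiv_zsmul, -self_sub_toIcoDiv_mul]
      ring
    rw [this]
    exact ⟨hn.1, hn.2.le⟩

/-- The infinite product `(w; q)_∞`. -/
noncomputable def qProd (q w : ℂ) : ℂ := ∏' n : ℕ, (1 + -(q ^ n * w))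

lemma summable_norm_pow_mul {q : ℂ} (hq : ‖q‖ < 1) (w : ℂ) :
    Summable fun n : ℕ => ‖-(q ^ n * w)‖ := by
  simpa [norm_mul, norm_pow] using
    (summable_geometric_of_lt_one (norm_nonneg _) hq).mul_right ‖w‖

lemma qProd_eq_mul {q : ℂ} (hq : ‖q‖ < 1) (w : ℂ) : qProd q w = (1 - w) * qProd q (q * w) := by
  have h : Multipliable fun n : ℕ => (1 + -(q ^ (n + 1) * w)) :=
    multipliable_one_add_of_summable
      ((summable_nat_add_iff 1).2 (summable_norm_pow_mul hq w))
  have h0 := tprod_eq_zero_mul' (f := fun n : ℕ => 1 + -(q ^ n * w)) h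
  have h1 : ∏' n : ℕ, (1 + -(q ^ (n + 1) * w)) = qProd q (q * w) :=
    tprod_congr fun n => by ring
  rw [h1, pow_zero, one_mul, ← sub_eq_add_neg] at h0
  exact h0

lemma qProd_ne_zero {q w : ℂ} (hq : ‖q‖ < 1) (h : ∀ n : ℕ, q ^ n * w ≠ 1) : qProd q w ≠ 0 := by
  refine tprod_one_add_ne_zero_of_summable (fun n h0 => h n ?_) (summable_norm_pow_mul hq w)
  linear_combination -h0

lemma qProd_eq_zero_iff {q w : ℂ} (hq : ‖q‖ < 1) : qProd q w = 0 ↔ ∃ n : ℕ, q ^ n * w = 1 := by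
  refine ⟨fun h => ?_, ?_⟩
  · by_contra! h'
    exact qProd_ne_zero hq h' h
  · rintro ⟨n, hn⟩
    induction n generalizing w with
    | zero =>
      rw [qProd_eq_mul hq, show w = 1 by simpa using hn]
      simp
    | succ n ih =>
      rw [qProd_eq_mul hq, ih (w := q * w) (by rw [← hn]; ring), mul_zero]

lemma differentiable_qProd {q : ℂ} (hq : ‖q‖ < 1) : Differentiable ℂ (qProd q) := by
  intro w
  have hw : w ∈ Metric.ball (0 : ℂ) (‖w‖ + 1) := by simp
  have h := Summable.hasProdLocallyUniformlyOn_nat_one_add (f := fun (n : ℕ) (w : ℂ) => -(q ^ n * w))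
    (K := Metric.ball (0 : ℂ) (‖w‖ + 1)) (u := fun n => ‖q‖ ^ n * (‖w‖ + 1)) Metric.isOpen_ball
    ((summable_geometric_of_lt_one (norm_nonneg _) hq).mul_right _)
    (.of_forall fun n x hx => by
      rw [norm_neg, norm_mul, norm_pow]
      have : ‖x‖ < ‖w‖ + 1 := by simpa using hx
      gcongr)
    (fun n => by fun_prop)
  have hd := h.differentiableOn (.of_forall fun s => by
    simpa [Finset.prod_fn] using DifferentiableOn.finsetProd (fun _ _ => by fun_prop))
    Metric.isOpen_ball
  exact (hd w hw).differentiableAt (Metric.isOpen_ball.mem_nhds hw)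

lemma deriv_qProd_ne_zero {q w : ℂ} (hq : ‖q‖ < 1) (h : qProd q w = 0) :
    deriv (qProd q) w ≠ 0 := by
  have hderiv : ∀ w, deriv (qProd q) w
      = -qProd q (q * w) + (1 - w) * (q * deriv (qProd q) (q * w)) := by
    intro w
    have h1 : HasDerivAt (fun w => qProd q (q * w)) (deriv (qProd q) (q * w) * q) w := by
      have := (differentiable_qProd hq (q * w)).hasDerivAt.comp w ((hasDerivAt_id w).const_mul q)
      rwa [mul_one] at this
    have h2 : HasDerivAt (fun w : ℂ => 1 - w) (-1) w := by
      simpa using (hasDerivAt_id w).const_sub 1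
    have h3 : HasDerivAt (qProd q) _ w :=
      (h2.mul h1).congr_of_eventuallyEq (.of_forall fun w => qProd_eq_mul hq w)
    rw [h3.deriv]
    ring
  obtain ⟨n, hn⟩ := (qProd_eq_zero_iff hq).1 h
  induction n generalizing w with
  | zero =>
    rw [hderiv, show w = 1 by simpa using hn]
    simp only [mul_one, sub_self, zero_mul, add_zero]
    refine neg_ne_zero.2 (qProd_ne_zero hq fun n hn => ?_)
    have := congrArg norm hn
    rw [← pow_succ, norm_pow, norm_one] at this
    exact (pow_lt_one₀ (norm_nonneg _) hq n.succ_ne_zero).ne this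
  | succ n ih =>
    have hn' : q ^ n * (q * w) = 1 := by rw [← hn]; ring
    have h0 := (qProd_eq_zero_iff hq).2 ⟨n, hn'⟩
    rw [hderiv, h0, neg_zero, zero_add]
    have hq0 : q ≠ 0 := by rintro rfl; simp at hn
    refine mul_ne_zero (fun h1 => ?_) (mul_ne_zero hq0 (ih h0 hn'))
    have h1 : w = 1 := by linear_combination -h1
    have := congrArg norm hn
    rw [h1, mul_one, norm_pow, norm_one] at this
    exact (pow_lt_one₀ (norm_nonneg _) hq n.succ_ne_zero).ne this

/-- An entire function with simple zeros exactly at the points of the lattice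
`ℤ h + ℤ 2πi`. -/
noncomputable def latticeTheta (h z : ℂ) : ℂ :=
  qProd (exp h) (exp z) * qProd (exp h) (exp h * exp (-z))

section
variable {h : ℝ}

lemma norm_exp_lt_one (hh : h < 0) : ‖exp (h : ℂ)‖ < 1 := by
  rw [norm_exp]
  simpa using hh

lemma differentiable_latticeTheta (hh : h < 0) : Differentiable ℂ (latticeTheta h) := by
  have := differentiable_qProd (norm_exp_lt_one hh)
  unfold latticeTheta
  fun_prop

lemma latticeTheta_add_two_pi_I (h z : ℂ) : latticeTheta h (z + 2 * Real.pi * I) =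
    latticeTheta h z := by
  rw [latticeTheta, latticeTheta, exp_neg, exp_periodic, exp_neg]

lemma latticeTheta_add (hh : h < 0) (z : ℂ) :
    latticeTheta h (z + h) = -exp (-z) * latticeTheta h z := by
  have hq := norm_exp_lt_one hh
  have h1 := qProd_eq_mul hq (exp z)
  have h2 := qProd_eq_mul hq (exp (-z))
  have h3 : exp (h : ℂ) * exp (-(z + h)) = exp (-z) := by rw [← exp_add]; congr 1; ring
  have h4 : exp (-z) * exp z = 1 := by rw [← exp_add]; simp
  rw [latticeTheta, latticeTheta, h3, h1, h2, exp_add, mul_comm (exp z)]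
  linear_combination (-qProd (exp h) (exp h * exp z) * qProd (exp h) (exp h * exp (-z))) * h4

lemma latticeTheta_eq_zero (hh : h < 0) {z : ℂ} (hz : latticeTheta h z = 0) :
    ∃ m n : ℤ, z = m * h + n * (2 * Real.pi * I) := by
  have hq := norm_exp_lt_one hh
  have key : ∃ m : ℤ, exp z = exp (m * h) := by
    rcases mul_eq_zero.1 hz with h0 | h0
    · obtain ⟨n, hn⟩ := (qProd_eq_zero_iff hq).1 h0
      refine ⟨-n, ?_⟩
      rw [← exp_nat_mul] at hn
      push_cast
      rw [neg_mul, exp_neg]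
      exact eq_inv_of_mul_eq_one_right hn
    · obtain ⟨n, hn⟩ := (qProd_eq_zero_iff hq).1 h0
      refine ⟨n + 1, ?_⟩
      rw [← exp_nat_mul, ← mul_assoc, ← exp_add, exp_neg, ← div_eq_mul_inv,
        div_eq_one_iff_eq (exp_ne_zero z)] at hn
      rw [← hn]
      congr 1
      push_cast
      ring
  obtain ⟨m, hm⟩ := key
  obtain ⟨n, hn⟩ := exp_eq_exp_iff_exists_int.1 hm
  exact ⟨m, n, hn⟩

lemma deriv_latticeTheta_ne_zero (hh : h < 0) {z : ℂ} (hz : latticeTheta h z = 0) :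
    deriv (latticeTheta h) z ≠ 0 := by
  have hq := norm_exp_lt_one hh
  have hd := differentiable_qProd hq
  have h1 : HasDerivAt (fun z => qProd (exp h) (exp z))
      (deriv (qProd (exp h)) (exp z) * exp z) z :=
    (hd (exp z)).hasDerivAt.comp z (hasDerivAt_exp z)
  have h2' : HasDerivAt (fun z : ℂ => exp h * exp (-z)) (exp h * -exp (-z)) z := by
    simpa using ((hasDerivAt_neg z).cexp).const_mul (exp (h : ℂ))
  have h2 := (hd (exp h * exp (-z))).hasDerivAt.comp z h2'
  have h3 : deriv (latticeTheta h) z = _ := (h1.mul h2).deriv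
  rw [h3]
  simp only [Function.comp_apply]
  rcases eq_or_ne (qProd (exp h) (exp z)) 0 with h0 | h0
  · have h4 : qProd (exp h) (exp h * exp (-z)) ≠ 0 := by
      intro h5
      obtain ⟨n, hn⟩ := (qProd_eq_zero_iff hq).1 h0
      obtain ⟨m, hm⟩ := (qProd_eq_zero_iff hq).1 h5
      have h6 : exp (h : ℂ) ^ (n + m + 1) = 1 := by
        have h7 : exp (-z) * exp z = 1 := by rw [← exp_add]; simp
        calc exp (h : ℂ) ^ (n + m + 1)
            = exp (h : ℂ) ^ (n + m + 1) * (exp (-z) * exp z) := by rw [h7, mul_one]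
          _ = (exp (h : ℂ) ^ n * exp z) * (exp (h : ℂ) ^ m * (exp h * exp (-z))) := by ring
          _ = 1 := by rw [hn, hm, mul_one]
      have := congrArg norm h6
      rw [norm_pow, norm_one] at this
      exact (pow_lt_one₀ (norm_nonneg _) hq (Nat.succ_ne_zero _)).ne this
    rw [h0, zero_mul, add_zero]
    exact mul_ne_zero (mul_ne_zero (deriv_qProd_ne_zero hq h0) (exp_ne_zero _)) h4
  · have h4 := (mul_eq_zero.1 hz).resolve_left h0
    rw [h4, mul_zero, zero_add]
    exact mul_ne_zero h0 (mul_ne_zero (deriv_qProd_ne_zero hq h4)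
      (mul_ne_zero (exp_ne_zero _) (neg_ne_zero.2 (exp_ne_zero _))))
end

/-- The entire function whose values at a lattice of points are, up to nonzero factors, the values
of the Gabor transform of `f` with respect to the periodized Gaussian. -/
noncomputable def gaborTheta (N : ℕ) [NeZero N] (lam : ℝ) (f : ZMod N → ℂ) (z : ℂ) : ℂ :=
  ∑ m : ZMod N, f m * (exp (-Real.pi * lam * (m.val : ℂ) ^ 2 / N ^ 2 + m.val * z) *
    jacobiTheta₂ (I * lam * m.val / N + N * z / (2 * Real.pi * I)) (I * lam))

/-- The point at which `gaborTheta` represents the Gabor transform at `(k, l)`. -/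
noncomputable def gaborPoint (N : ℕ) (lam : ℝ) (k l : ZMod N) : ℂ :=
  2 * Real.pi * lam * k.val / N ^ 2 - 2 * Real.pi * I * l.val / N

lemma gaborPoint_eq (N : ℕ) (lam : ℝ) (k l : ZMod N) : gaborPoint N lam k l =
    ((2 * Real.pi * lam * k.val / N ^ 2 : ℝ) : ℂ) + ((-2 * Real.pi * l.val / N : ℝ) : ℂ) * I := by
  rw [gaborPoint]
  push_cast
  ring

section
variable {N : ℕ} [NeZero N] {lam : ℝ}

lemma I_mul_im_pos (hlam : 0 < lam) : 0 < (I * (lam : ℂ)).im := by simpa using hlam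

lemma differentiable_gaborTheta (hlam : 0 < lam) (f : ZMod N → ℂ) :
    Differentiable ℂ (gaborTheta N lam f) := by
  have h : Differentiable ℂ fun z => jacobiTheta₂ z (I * lam) := fun z =>
    differentiableAt_jacobiTheta₂_fst z (I_mul_im_pos hlam)
  unfold gaborTheta
  refine Differentiable.fun_sum fun m _ => Differentiable.const_mul (Differentiable.mul ?_ ?_) _
  · fun_prop
  · exact h.comp (f := fun z : ℂ => I * lam * m.val / N + N * z / (2 * Real.pi * I))
      (by fun_prop)

lemma jacobiTheta₂_add_int (z τ : ℂ) (n : ℤ) : jacobiTheta₂ (z + n) τ = jacobiTheta₂ z τ := by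
  have h : Function.Periodic (fun z => jacobiTheta₂ z τ) 1 := fun z => jacobiTheta₂_add_left z τ
  simpa using h.int_mul n z

lemma gaborTheta_add_two_pi_I (f : ZMod N → ℂ) (z : ℂ) :
    gaborTheta N lam f (z + 2 * Real.pi * I) = gaborTheta N lam f z := by
  refine sum_congr rfl fun m _ => ?_
  have h1 : -Real.pi * lam * (m.val : ℂ) ^ 2 / N ^ 2 + m.val * (z + 2 * Real.pi * I) =
      (-Real.pi * lam * (m.val : ℂ) ^ 2 / N ^ 2 + m.val * z) + m.val * (2 * Real.pi * I) := by ring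
  have h2 : I * lam * m.val / N + N * (z + 2 * Real.pi * I) / (2 * Real.pi * I) =
      (I * lam * m.val / N + N * z / (2 * Real.pi * I)) + (N : ℤ) := by
    have := two_pi_I_ne_zero
    rw [mul_add, add_div, mul_div_assoc (N : ℂ) (2 * Real.pi * I), div_self this]
    push_cast
    ring
  rw [h1, h2, jacobiTheta₂_add_int, exp_add _ (m.val * (2 * Real.pi * I)),
    exp_nat_mul_two_pi_mul_I, mul_one]

lemma gaborTheta_add (f : ZMod N → ℂ) (z : ℂ) :
    gaborTheta N lam f (z + (-2 * Real.pi * lam / N : ℝ)) =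
      exp (Real.pi * lam - N * z) * gaborTheta N lam f z := by
  have hN : (N : ℂ) ≠ 0 := NeZero.ne _
  have hpi : (Real.pi : ℂ) ≠ 0 := ofReal_ne_zero.2 Real.pi_ne_zero
  rw [gaborTheta, gaborTheta, mul_sum]
  refine sum_congr rfl fun m _ => ?_
  have h2 : I * lam * m.val / N + N * (z + (-2 * Real.pi * lam / N : ℝ)) / (2 * Real.pi * I) =
      (I * lam * m.val / N + N * z / (2 * Real.pi * I)) + I * lam := by
    push_cast
    field_simp
    linear_combination (-2 * lam * Real.pi * N : ℂ) * I_sq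
  rw [h2, jacobiTheta₂_add_left', ← mul_assoc (exp _), ← exp_add, mul_left_comm (exp _) (f m),
    ← mul_assoc (exp _), ← exp_add]
  congr 3
  push_cast
  field_simp
  ring_nf
  simp only [I_sq]
  ring

lemma periodizedGaussian_intCast (a : ℤ) :
    periodizedGaussian N lam (a : ZMod N) =
      ((∑' j : ℤ, Real.exp (-Real.pi * lam * ((a : ℝ) / N - j) ^ 2) : ℝ) : ℂ) := by
  have hN : (N : ℝ) ≠ 0 := NeZero.ne _
  rw [periodizedGaussian]
  congr 1
  rw [← (Equiv.subRight (a / (N : ℤ))).tsum_eq]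
  refine tsum_congr fun j => ?_
  have h1 : (((a : ZMod N).val : ℤ) : ℝ) = ((a - N * (a / N) : ℤ) : ℝ) := by
    rw [ZMod.val_intCast, Int.emod_def]
  rw [Int.cast_natCast] at h1
  rw [h1]
  congr 2
  simp only [Equiv.subRight_apply]
  push_cast
  field_simp
  ring

lemma periodizedGaussian_eq_jacobiTheta₂ (a : ℤ) :
    periodizedGaussian N lam (a : ZMod N) =
      exp (-Real.pi * lam * a ^ 2 / N ^ 2) * jacobiTheta₂ (I * lam * a / N) (I * lam) := by
  have hN : (N : ℂ) ≠ 0 := NeZero.ne _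
  rw [periodizedGaussian_intCast, ← jacobiTheta₂_neg_left, jacobiTheta₂, ← tsum_mul_left,
    ofReal_tsum]
  refine tsum_congr fun j => ?_
  rw [jacobiTheta₂_term, ← exp_add, ofReal_exp]
  congr 1
  push_cast
  field_simp
  ring_nf
  simp only [I_sq]
  ring

lemma finiteGabor_eq_gaborTheta (f : ZMod N → ℂ) (k l : ZMod N) :
    finiteGabor (periodizedGaussian N lam) f k l =
      exp (-Real.pi * lam * (k.val : ℂ) ^ 2 / N ^ 2) *
        gaborTheta N lam f (gaborPoint N lam k l) := by
  have hN : (N : ℂ) ≠ 0 := NeZero.ne _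
  have hpi : (Real.pi : ℂ) ≠ 0 := ofReal_ne_zero.2 Real.pi_ne_zero
  rw [finiteGabor, gaborTheta, mul_sum]
  refine sum_congr rfl fun m _ => ?_
  have h0 : (starRingEnd ℂ) (periodizedGaussian N lam (m - k)) =
      periodizedGaussian N lam (m - k) := by
    rw [periodizedGaussian, conj_ofReal]
  have h1 : m - k = (((m.val : ℤ) - (k.val : ℤ) : ℤ) : ZMod N) := by simp
  have h2 : I * lam * m.val / N + N * gaborPoint N lam k l / (2 * Real.pi * I) =
      I * lam * ((m.val - k.val : ℤ) : ℂ) / N + (-l.val : ℤ) := by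
    rw [gaborPoint]
    push_cast
    field_simp
    ring_nf
    simp only [I_sq]
    ring
  rw [h0, h1, periodizedGaussian_eq_jacobiTheta₂, h2, jacobiTheta₂_add_int, mul_assoc,
    mul_left_comm (exp _) (f m), ← mul_assoc (exp _), ← exp_add, mul_right_comm, ← exp_add]
  congr 3
  rw [gaborPoint]
  push_cast
  field_simp
  ring

lemma periodizedGaussian_ne_zero (hlam : 0 < lam) (m : ZMod N) :
    periodizedGaussian N lam m ≠ 0 := by
  have hs := (summable_jacobiTheta₂_term_iff (-(I * lam * m.val / N)) (I * lam)).2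
    (I_mul_im_pos hlam)
  have hN : (N : ℂ) ≠ 0 := NeZero.ne _
  have hsum : Summable fun j : ℤ => Real.exp (-Real.pi * lam * ((m.val : ℝ) / N - j) ^ 2) := by
    rw [← summable_ofReal]
    refine (hs.mul_left (exp (-Real.pi * lam * m.val ^ 2 / N ^ 2))).congr fun j => ?_
    rw [jacobiTheta₂_term, ← exp_add, ofReal_exp]
    congr 1
    push_cast
    field_simp
    ring_nf
    simp only [I_sq]
    ring
  rw [periodizedGaussian, ofReal_ne_zero]
  exact (hsum.tsum_pos (fun _ => (Real.exp_pos _).le) 0 (Real.exp_pos _)).ne'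

lemma eq_zero_of_gaborTheta_eq_zero (hlam : 0 < lam) {f : ZMod N → ℂ}
    (hf : ∀ z, gaborTheta N lam f z = 0) : f = 0 := by
  have h : ZMod.dft (fun m => f m * periodizedGaussian N lam m) = 0 := by
    funext l
    have := finiteGabor_eq_gaborTheta (lam := lam) f 0 l
    rw [hf, mul_zero, finiteGabor] at this
    rw [ZMod.dft_apply, Pi.zero_apply, ← this]
    refine sum_congr rfl fun m _ => ?_
    have h1 : -(m * l) = ((-(m.val * l.val) : ℤ) : ZMod N) := by simp
    have h2 : (starRingEnd ℂ) (periodizedGaussian N lam m) = periodizedGaussian N lam m := by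
      rw [periodizedGaussian, conj_ofReal]
    rw [h1, ZMod.stdAddChar_coe, sub_zero, h2, smul_eq_mul, mul_comm]
    congr 2
    push_cast
    ring
  rw [LinearEquiv.map_eq_zero_iff] at h
  funext m
  exact (mul_eq_zero.1 (congrFun h m)).resolve_right (periodizedGaussian_ne_zero hlam m)

lemma gaborTheta_lattice_eq_zero {f : ZMod N → ℂ} {z : ℂ} (hz : gaborTheta N lam f z = 0)
    (m n : ℤ) :
    gaborTheta N lam f (z + (m * (-2 * Real.pi * lam / N : ℝ) + n * (2 * Real.pi * I))) = 0 := by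
  have h1 : Function.Periodic (fun z => gaborTheta N lam f z = 0) (2 * Real.pi * I) := fun z => by
    simp only [gaborTheta_add_two_pi_I]
  have h2 : Function.Periodic (fun z => gaborTheta N lam f z = 0)
      ((-2 * Real.pi * lam / N : ℝ) : ℂ) := fun z => by
    simp only [gaborTheta_add, mul_eq_zero, exp_ne_zero, false_or]
  rw [← add_assoc]
  exact (h1.int_mul n _).mpr ((h2.int_mul m _).mpr hz)

lemma gaborPoint_injective_mod_lattice (hlam : 0 < lam) {k l k' l' : ZMod N} {m n : ℤ}
    (h : gaborPoint N lam k l - gaborPoint N lam k' l' =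
      m * (-2 * Real.pi * lam / N : ℝ) + n * (2 * Real.pi * I)) : k = k' ∧ l = l' := by
  have hN : (N : ℝ) ≠ 0 := NeZero.ne _
  have hre := congrArg re h
  have him := congrArg im h
  rw [gaborPoint_eq, gaborPoint_eq] at hre him
  simp only [sub_re, sub_im, add_re, add_im, mul_re, mul_im, ofReal_re, ofReal_im, I_re, I_im,
    intCast_re, intCast_im, re_ofNat, im_ofNat, mul_zero, zero_mul, add_zero, sub_zero,
    zero_add, mul_one] at hre him
  have hk : ((k.val : ℤ) - k'.val : ℤ) = -m * N := by
    have : (k.val : ℝ) - k'.val = -m * N := by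
      field_simp at hre
      linear_combination hre
    exact_mod_cast this
  have hl : ((l.val : ℤ) - l'.val : ℤ) = -n * N := by
    have : (l.val : ℝ) - l'.val = -n * N := by
      field_simp at him
      linear_combination -him
    exact_mod_cast this
  constructor
  · simpa [sub_eq_zero] using congrArg (Int.cast : ℤ → ZMod N) hk
  · simpa [sub_eq_zero] using congrArg (Int.cast : ℤ → ZMod N) hl

/-- A Gabor transform with respect to the periodized Gaussian that vanishes at `N` distinct points
vanishes identically when `N` is odd. -/
lemma eq_zero_of_finiteGabor_eq_zero (hodd : Odd N) (hlam : 0 < lam)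
    {p : Fin N → ZMod N × ZMod N} (hp : Function.Injective p) {f : ZMod N → ℂ}
    (hf : ∀ i, finiteGabor (periodizedGaussian N lam) f (p i).1 (p i).2 = 0) : f = 0 := by
  have hNpos : (0 : ℝ) < N := Nat.cast_pos.2 (NeZero.pos N)
  set h : ℝ := -2 * Real.pi * lam / N with hdef
  have hh : h < 0 := by
    have : 0 < 2 * Real.pi * lam / N := by positivity
    rw [hdef, neg_mul, neg_mul, neg_div]
    linarith
  set a : Fin N → ℂ := fun i => gaborPoint N lam (p i).1 (p i).2 with ha
  set F := gaborTheta N lam f with hF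
  set s : Fin N → ℂ → ℂ := fun i z => latticeTheta h (z - a i) with hs
  have hsd : ∀ i, Differentiable ℂ (s i) := fun i =>
    (differentiable_latticeTheta hh).comp (differentiable_id.sub_const _)
  have hFd : Differentiable ℂ F := differentiable_gaborTheta hlam f
  have hFa : ∀ i, F (a i) = 0 := fun i => by
    have := hf i
    rw [finiteGabor_eq_gaborTheta] at this
    exact (mul_eq_zero.1 this).resolve_left (exp_ne_zero _)
  have hsimple : ∀ i z, s i z = 0 → deriv (s i) z ≠ 0 := fun i z hz => by
    rw [hs, deriv_comp_sub_const]
    exact deriv_latticeTheta_ne_zero hh hz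
  have hsne : ∀ i, ∃ z, s i z ≠ 0 := fun i => by
    by_contra! h0
    refine hsimple i 0 (h0 0) ?_
    rw [show s i = fun _ => 0 from funext h0, deriv_const]
  obtain ⟨G, hGd, hG⟩ := exists_differentiable_eq_prod_mul univ hsd hFd hsimple
    (fun i j z hi hj => by
      obtain ⟨m, n, h1⟩ := latticeTheta_eq_zero hh hi
      obtain ⟨m', n', h2⟩ := latticeTheta_eq_zero hh hj
      have h3 : a i - a j = ((m' - m : ℤ) : ℂ) * h + ((n' - n : ℤ) : ℂ) * (2 * Real.pi * I) := by
        push_cast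
        linear_combination h2 - h1
      have := gaborPoint_injective_mod_lattice hlam h3
      exact hp (Prod.ext this.1 this.2))
    (fun i z hz => by
      obtain ⟨m, n, h1⟩ := latticeTheta_eq_zero hh hz
      rw [← add_sub_cancel (a i) z, h1]
      exact gaborTheta_lattice_eq_zero (hFa i) m n)
  have hG1 : ∀ z, G (z + 2 * Real.pi * I) = G z := by
    intro z
    rw [← sub_eq_zero]
    refine eq_zero_of_prod_mul_eq_zero univ hsd hsne
      (g := fun z => G (z + 2 * Real.pi * I) - G z) (by fun_prop) (fun z => ?_) z
    have h1 : ∀ i, s i (z + 2 * Real.pi * I) = s i z := fun i => by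
      simp only [hs]
      rw [← latticeTheta_add_two_pi_I (h : ℂ) (z - a i)]
      congr 1
      ring
    have h2 : F (z + 2 * Real.pi * I) = F z := gaborTheta_add_two_pi_I f z
    rw [hG, hG, prod_congr rfl fun i _ => h1 i] at h2
    rw [mul_sub, h2, sub_self]
  set A : ℂ := ∑ i, a i with hA
  have hG2 : ∀ z, G (z + h) = (-1) ^ N * exp (Real.pi * lam - A) * G z := by
    intro z
    rw [← sub_eq_zero]
    refine eq_zero_of_prod_mul_eq_zero univ hsd hsne
      (g := fun z => G (z + h) - (-1) ^ N * exp (Real.pi * lam - A) * G z) (by fun_prop)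
      (fun z => ?_) z
    have h1 : ∀ i, s i (z + h) = -exp (-(z - a i)) * s i z := fun i => by
      simp only [hs]
      rw [← latticeTheta_add hh]
      congr 1
      ring
    have h2 : F (z + h) = exp (Real.pi * lam - N * z) * F z := gaborTheta_add f z
    have h3 : ∏ i, -exp (-(z - a i)) = (-1) ^ N * exp (A - N * z) := by
      rw [prod_neg, ← exp_sum]
      simp [hA, sub_eq_add_neg, sum_add_distrib, add_comm]
    rw [hG, hG, prod_congr rfl fun i _ => h1 i, prod_mul_distrib, h3] at h2
    have h4 : (-1 : ℂ) ^ N * (-1) ^ N = 1 := by rw [← mul_pow]; simp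
    have h5 : exp (Real.pi * lam - N * z) = exp (Real.pi * lam - A) * exp (A - N * z) := by
      rw [← exp_add]; congr 1; ring
    rw [h5] at h2
    have h6 : exp (A - N * z) * ((∏ i, s i z) *
        (G (z + h) - (-1) ^ N * exp (Real.pi * lam - A) * G z)) = 0 := by
      linear_combination (-1) ^ N * h2 - exp (A - N * z) * (∏ i, s i z) * G (z + h) * h4
    exact (mul_eq_zero.1 h6).resolve_left (exp_ne_zero _)
  set K : ℕ := ∑ i, (p i).1.val with hK
  have hAre : A.re = 2 * Real.pi * lam * K / N ^ 2 := by
    rw [hA, re_sum, hK]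
    push_cast
    rw [mul_sum, sum_div]
    refine sum_congr rfl fun i _ => ?_
    rw [ha]
    simp only [gaborPoint_eq, add_re, mul_re, ofReal_re, ofReal_im, I_re, I_im]
    ring
  set b : ℝ := ((N : ℝ) ^ 2 - 2 * K) / (2 * N) with hb
  set H : ℂ → ℂ := fun z => G z * exp (b * z) with hH
  have hHconst : ∀ z w, H z = H w := by
    refine apply_eq_apply_of_periodic_norm (a := -h) (b := 2 * Real.pi) (by fun_prop)
      (neg_pos.2 hh) (by positivity) (fun z => ?_) (fun z => ?_)
    · have h1 := hG2 (z + (-h : ℝ))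
      have h2 : z + ((-h : ℝ) : ℂ) + h = z := by push_cast; ring
      rw [h2] at h1
      simp only [hH]
      rw [h1]
      simp only [norm_mul, norm_pow, norm_neg, norm_one, one_pow, one_mul, norm_exp]
      rw [mul_right_comm, ← Real.exp_add, mul_comm]
      congr 2
      simp only [sub_re, mul_re, ofReal_re, ofReal_im, add_re, hAre]
      rw [hb, hdef]
      field_simp
      ring
    · have h1 : ((2 * Real.pi : ℝ) : ℂ) * I = 2 * Real.pi * I := by push_cast; rfl
      simp only [hH, norm_mul, norm_exp]
      rw [h1, hG1]
      simp
  have hG0 : ∀ z, G z = 0 := by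
    have h0 : H 0 = 0 := by
      by_contra hne
      have h1 := hHconst (0 + 2 * Real.pi * I) 0
      simp only [hH] at h1 hne
      rw [hG1, mul_zero, exp_zero, mul_one, zero_add] at h1
      rw [mul_zero, exp_zero, mul_one] at hne
      have h2 : exp (b * (2 * Real.pi * I)) = 1 := mul_left_cancel₀ hne (by rw [h1, mul_one])
      obtain ⟨n, hn⟩ := exp_eq_one_iff.1 h2
      have h3 : (b : ℂ) = n := mul_right_cancel₀ two_pi_I_ne_zero hn
      have h4 : b = n := by exact_mod_cast h3
      rw [hb, div_eq_iff (by positivity)] at h4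
      have h5 : (N : ℤ) ^ 2 - 2 * K = n * (2 * N) := by exact_mod_cast h4
      have h6 : Odd ((N : ℤ) ^ 2) := (by exact_mod_cast hodd : Odd (N : ℤ)).pow
      obtain ⟨c, hc⟩ := h6
      have : (2 : ℤ) * (n * N + K - c) = 1 := by linear_combination hc - h5
      omega
    intro z
    have := hHconst z 0
    rw [h0] at this
    exact (mul_eq_zero.1 this).resolve_right (exp_ne_zero _)
  exact eq_zero_of_gaborTheta_eq_zero hlam fun z => by rw [← hF, hG, hG0, mul_zero]

end

theorem odd_N_periodized_gaussian_general_position (N : ℕ) [NeZero N] (hodd : Odd N)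
    (lam : ℝ) (hlam : 0 < lam)
    (p : Fin N → ZMod N × ZMod N) (hp : Function.Injective p) :
    ∃ A B : ℝ, 0 < A ∧ 0 < B ∧ ∀ f : ZMod N → ℂ,
      A * ∑ m : ZMod N, ‖f m‖ ^ 2 ≤
        (∑ k : Fin N, ‖finiteGabor (periodizedGaussian N lam) f (p k).1 (p k).2‖ ^ 2) ∧
      (∑ k : Fin N, ‖finiteGabor (periodizedGaussian N lam) f (p k).1 (p k).2‖ ^ 2) ≤
        B * ∑ m : ZMod N, ‖f m‖ ^ 2 := by
  let L : EuclideanSpace ℂ (ZMod N) →ₗ[ℂ] EuclideanSpace ℂ (Fin N) :=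
    { toFun := fun f => WithLp.toLp 2 fun k =>
        finiteGabor (periodizedGaussian N lam) f (p k).1 (p k).2
      map_add' := fun f g => by
        ext k
        simp [finiteGabor, add_mul, sum_add_distrib]
      map_smul' := fun c f => by
        ext k
        simp [finiteGabor, mul_sum, mul_assoc] }
  have hker : LinearMap.ker L = ⊥ := by
    rw [LinearMap.ker_eq_bot']
    intro f hf
    have := eq_zero_of_finiteGabor_eq_zero hodd hlam hp (f := f) fun i =>
      congrFun (congrArg WithLp.ofLp hf) i
    ext i
    exact congrFun this i
  obtain ⟨K, hK, hanti⟩ := L.exists_antilipschitzWith hker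
  have hK' : (0 : ℝ) < K := by exact_mod_cast hK
  let T := LinearMap.toContinuousLinearMap L
  refine ⟨((K : ℝ) ^ 2)⁻¹, ‖T‖ ^ 2 + 1, by positivity, by positivity, fun f => ?_⟩
  have h1 : ∑ m : ZMod N, ‖f m‖ ^ 2 = ‖WithLp.toLp 2 f‖ ^ 2 :=
    (EuclideanSpace.norm_sq_eq (WithLp.toLp 2 f)).symm
  have h2 : ∑ k : Fin N, ‖finiteGabor (periodizedGaussian N lam) f (p k).1 (p k).2‖ ^ 2 =
      ‖L (WithLp.toLp 2 f)‖ ^ 2 :=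
    (EuclideanSpace.norm_sq_eq (L (WithLp.toLp 2 f))).symm
  rw [h1, h2]
  constructor
  · have h3 := hanti.le_mul_dist (WithLp.toLp 2 f) 0
    rw [map_zero, dist_zero_right, dist_zero_right] at h3
    rw [inv_mul_le_iff₀ (by positivity), ← mul_pow]
    gcongr
  · have h3 : ‖L (WithLp.toLp 2 f)‖ ≤ ‖T‖ * ‖WithLp.toLp 2 f‖ := T.le_opNorm _
    calc ‖L (WithLp.toLp 2 f)‖ ^ 2 ≤ (‖T‖ * ‖WithLp.toLp 2 f‖) ^ 2 := by gcongr
      _ ≤ (‖T‖ ^ 2 + 1) * ‖WithLp.toLp 2 f‖ ^ 2 := by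
        rw [mul_pow]
        gcongr
        linarith
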